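/- Strict monotonicity under radial contraction: if x ∈ B satisfies 1/2 < ‖x‖, and 0 ≤ a < 1, then 𝒫(x) is a proper subset of 𝒫(a • x); that is, every y ∈ S with x ∈ B_y also satisfies a • x ∈ B_y, and moreover there exists y ∈ S with a • x ∈ B_y but x ∉ B_y. -/

import Mathlib

open Metric

/-- Membership of `z` in the ball tangent to the unit sphere at `y`, via the inner product. -/
lemma mem_closedBall_quarter_smul_iff {E : Type*} [NormedAddCommGroup E]
    [InnerProductSpace ℝ E] {y : E} (hy : ‖y‖ = 1) (z : E) :
    z ∈ closedBall ((1/4 : ℝ) • y) (3/4) ↔ 2 * ‖z‖ ^ 2 - 1 ≤ inner ℝ z y := by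
  have h : ‖z - (1/4 : ℝ) • y‖ ^ 2 = ‖z‖ ^ 2 - inner ℝ z y / 2 + 1 / 16 := by
    rw [norm_sub_sq_real, inner_smul_right, norm_smul, hy]
    norm_num
    ring
  rw [mem_closedBall, dist_eq_norm, ← sq_le_sq₀ (norm_nonneg _) (by norm_num), h]
  constructor <;> intro _ <;> linarith

/-- In dimension at least two, a unit vector can be found at any prescribed angle to a nonzero
vector. -/
lemma exists_norm_eq_one_inner_eq_norm_mul {n : ℕ} (hn : 1 ≤ n)
    {x : EuclideanSpace ℝ (Fin (n + 1))} (hx : x ≠ 0) {c : ℝ} (hc : c ^ 2 ≤ 1) :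
    ∃ y : EuclideanSpace ℝ (Fin (n + 1)), ‖y‖ = 1 ∧ inner ℝ x y = ‖x‖ * c := by
  have : Fact (Module.finrank ℝ (EuclideanSpace ℝ (Fin (n + 1))) = n + 1) := ⟨by simp⟩
  have hrank := Submodule.finrank_orthogonal_span_singleton (𝕜 := ℝ) (n := n) hx
  have : Nontrivial (ℝ ∙ x)ᗮ := Module.nontrivial_of_finrank_pos (R := ℝ) (by omega)
  obtain ⟨v, hv⟩ := exists_norm_eq (ℝ ∙ x)ᗮ zero_le_one
  have hxv : inner ℝ x (v : EuclideanSpace ℝ (Fin (n + 1))) = 0 :=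
    Submodule.mem_orthogonal_singleton_iff_inner_right.1 v.2
  have hv' : ‖(v : EuclideanSpace ℝ (Fin (n + 1)))‖ = 1 := hv
  have hr : ‖x‖ ≠ 0 := norm_ne_zero_iff.2 hx
  refine ⟨(c / ‖x‖) • x + √(1 - c ^ 2) • (v : EuclideanSpace ℝ (Fin (n + 1))), ?_, ?_⟩
  · rw [← sq_eq_sq₀ (norm_nonneg _) zero_le_one, norm_add_sq_real, inner_smul_left,
      inner_smul_right, hxv, norm_smul, norm_smul, hv', mul_pow, mul_pow, Real.norm_eq_abs,
      Real.norm_eq_abs, sq_abs, sq_abs, Real.sq_sqrt (by linarith)]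
    field_simp
    simp
  · rw [inner_add_right, inner_smul_right, inner_smul_right, hxv, real_inner_self_eq_norm_sq]
    field_simp
    simp

/-- Strict monotonicity under radial contraction: if `x` is in the closed unit ball with
`1/2 < ‖x‖` and `0 ≤ a < 1`, then `𝒫(x) ⊊ 𝒫(a • x)`: every `y ∈ S` with `x ∈ B_y` also has
`a • x ∈ B_y`, and there exists `y ∈ S` with `a • x ∈ B_y` but `x ∉ B_y`. -/
theorem stmt_3 (n : ℕ) (hn : 1 ≤ n) (x : EuclideanSpace ℝ (Fin (n + 1)))
    (hx : x ∈ closedBall (0 : EuclideanSpace ℝ (Fin (n + 1))) 1)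
    (hx' : 1/2 < ‖x‖) (a : ℝ) (ha0 : 0 ≤ a) (ha1 : a < 1) :
    (∀ y ∈ sphere (0 : EuclideanSpace ℝ (Fin (n + 1))) 1,
      x ∈ closedBall ((1/4 : ℝ) • y) (3/4) → a • x ∈ closedBall ((1/4 : ℝ) • y) (3/4)) ∧
    (∃ y ∈ sphere (0 : EuclideanSpace ℝ (Fin (n + 1))) 1,
      a • x ∈ closedBall ((1/4 : ℝ) • y) (3/4) ∧ x ∉ closedBall ((1/4 : ℝ) • y) (3/4)) := by
  have hr1 : ‖x‖ ≤ 1 := mem_closedBall_zero_iff.1 hx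
  have hnorm : ‖a • x‖ = a * ‖x‖ := by rw [norm_smul, Real.norm_of_nonneg ha0]
  constructor
  · intro y hy hxy
    have h0 : (0 : EuclideanSpace ℝ (Fin (n + 1))) ∈ closedBall ((1/4 : ℝ) • y) (3/4) := by
      rw [mem_closedBall_quarter_smul_iff (mem_sphere_zero_iff_norm.1 hy)]
      simp
    exact (convex_closedBall _ _).smul_mem_of_zero_mem h0 hxy ⟨ha0, ha1.le⟩
  · have hx0 : x ≠ 0 := norm_pos_iff.1 (by linarith)
    set r := ‖x‖
    have har : a * r < r := by nlinarith
    have har0 : 0 ≤ a * r := mul_nonneg ha0 (by linarith)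
    obtain ⟨c, hc, hac, hcr⟩ : ∃ c : ℝ, c ^ 2 ≤ 1 ∧ 2 * (a * r) ^ 2 - 1 ≤ a * (r * c) ∧
        r * c < 2 * r ^ 2 - 1 := by
      rcases le_total (a * r) (1/2) with hs | hs
      · exact ⟨-1, by norm_num, by nlinarith, by nlinarith⟩
      · have hs0 : 0 < a * r := by linarith
        obtain ⟨c, hc⟩ : ∃ c : ℝ, (a * r) * c = 2 * (a * r) ^ 2 - 1 :=
          ⟨(2 * (a * r) ^ 2 - 1) / (a * r), mul_div_cancel₀ _ hs0.ne'⟩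
        refine ⟨c, ?_, by linarith, ?_⟩
        · have h1 : -1 ≤ c := by
            refine le_of_mul_le_mul_left ?_ hs0
            nlinarith
          have h2 : c ≤ 1 := by
            refine le_of_mul_le_mul_left ?_ hs0
            nlinarith
          nlinarith
        · refine lt_of_mul_lt_mul_left ?_ hs0.le
          have : 0 < (r - a * r) * (2 * r * (a * r) + 1) :=
            mul_pos (by linarith) (by positivity)
          have : a * r * (r * c) = r * (2 * (a * r) ^ 2 - 1) := by rw [← hc]; ring
          nlinarith
    obtain ⟨y, hy, hxy⟩ := exists_norm_eq_one_inner_eq_norm_mul hn hx0 hc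
    refine ⟨y, mem_sphere_zero_iff_norm.2 hy, ?_, ?_⟩
    · rw [mem_closedBall_quarter_smul_iff hy, hnorm, real_inner_smul_left, hxy]
      exact hac
    · rw [mem_closedBall_quarter_smul_iff hy, hxy]
      exact not_le.2 hcr
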